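/- Without VSL control (speed limit u = v_f) and with demand d⁻ > C, the congested equilibrium is globally attracting: if k : [0,∞) → ℝ is differentiable, satisfies l0*k'(t) = F(v_f, k(t)) − G(k(t)) for all t ≥ 0, and k(0) ∈ [0, k_j], then k(t) ∈ [0, k_j] for all t ≥ 0 and k(t) → k2 as t → ∞; consequently the discharging flow-rate converges to the dropped capacity (1−Δ)C. -/

import Mathlib

/-- In-flux function of the link queue model:
`F(u,k) = min{d⁻, u*w*k_j/(u+w), w*(k_j−k)}`. -/
noncomputable def influx (dm w kj u k : ℝ) : ℝ :=
  min dm (min (u * w * kj / (u + w)) (w * (kj - k)))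

/-- Out-flux (discharging flow-rate) with capacity drop:
`G(k) = v_f*k` if `k ≤ k1 = C/v_f`, and `(1−Δ)*C` otherwise. -/
noncomputable def outflux (vf C Δ k : ℝ) : ℝ :=
  if k ≤ C / vf then vf * k else (1 - Δ) * C
/-- A trajectory on which `y²` is dissipated at a rate that is quadratic near the origin and linear
away from it tends to the origin. -/
theorem tendsto_zero_of_mul_deriv_le {y : ℝ → ℝ} {a c w : ℝ} (ha : 0 < a) (hc : 0 < c) (hw : 0 < w)
    (hy : Differentiable ℝ y)
    (h : ∀ t, 0 ≤ t → y t * deriv y t ≤ -(a * (|y t| * min c (w * |y t|)))) :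
    Filter.Tendsto y Filter.atTop (nhds 0) := by
  have hsq : Differentiable ℝ fun t => y t ^ 2 := hy.pow 2
  have hderiv : ∀ t, HasDerivAt (fun t => y t ^ 2) (2 * (y t * deriv y t)) t := fun t =>
    ((hy t).hasDerivAt.pow 2).congr_deriv (by push_cast; ring)
  have hanti : AntitoneOn (fun t => y t ^ 2) (Set.Ici 0) := by
    refine antitoneOn_of_deriv_nonpos (convex_Ici 0) hsq.continuous.continuousOn
      hsq.differentiableOn fun t ht => ?_
    rw [interior_Ici] at ht
    rw [(hderiv t).deriv]
    have hpos : 0 ≤ a * (|y t| * min c (w * |y t|)) := by positivity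
    linarith [h t ht.le]
  set M := |y 0| + 1 with hM_def
  have hM : 0 < M := by positivity
  have hbound : ∀ t, 0 ≤ t → |y t| ≤ M := fun t ht =>
    (sq_le_sq.1 (hanti (Set.mem_Ici.2 le_rfl) ht ht)).trans (by linarith)
  set r := min (c / M) w with hr_def
  have hr : 0 < r := lt_min (by positivity) hw
  have hquad : ∀ t, 0 ≤ t → r * y t ^ 2 ≤ |y t| * min c (w * |y t|) := fun t ht => by
    have habs := abs_nonneg (y t)
    have hle : r * |y t| ≤ min c (w * |y t|) := by
      refine le_min ?_ (mul_le_mul_of_nonneg_right (min_le_right _ _) habs)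
      calc r * |y t| ≤ c / M * M := by
            gcongr
            · exact min_le_left _ _
            · exact hbound t ht
        _ = c := by field_simp
    calc r * y t ^ 2 = |y t| * (r * |y t|) := by rw [← sq_abs]; ring
      _ ≤ _ := mul_le_mul_of_nonneg_left hle habs
  have hexp : ∀ t, HasDerivAt (fun t => y t ^ 2 * Real.exp (2 * a * r * t))
      ((2 * (y t * deriv y t) + 2 * a * r * y t ^ 2) * Real.exp (2 * a * r * t)) t := fun t =>
    ((hderiv t).mul ((hasDerivAt_id t).const_mul (2 * a * r)).exp).congr_deriv
      (by simp only [id, mul_one]; ring)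
  have hanti' : AntitoneOn (fun t => y t ^ 2 * Real.exp (2 * a * r * t)) (Set.Ici 0) := by
    refine antitoneOn_of_deriv_nonpos (convex_Ici 0)
      (fun t _ => (hexp t).continuousAt.continuousWithinAt)
      (fun t _ => (hexp t).differentiableAt.differentiableWithinAt) fun t ht => ?_
    rw [interior_Ici] at ht
    rw [(hexp t).deriv]
    refine mul_nonpos_of_nonpos_of_nonneg ?_ (Real.exp_pos _).le
    nlinarith [h t ht.le, mul_le_mul_of_nonneg_left (hquad t ht.le) ha.le]
  have hdecay : ∀ t, 0 ≤ t → y t ^ 2 ≤ y 0 ^ 2 * Real.exp (-(2 * a * r * t)) := fun t ht => by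
    have hle := hanti' (Set.mem_Ici.2 le_rfl) ht ht
    rw [Real.exp_neg, ← div_eq_mul_inv, le_div_iff₀ (Real.exp_pos _)]
    simpa using hle
  have hlim : Filter.Tendsto (fun t => y 0 ^ 2 * Real.exp (-(2 * a * r * t)))
      Filter.atTop (nhds 0) := by
    simpa using (Real.tendsto_exp_neg_atTop_nhds_zero.comp
      (Filter.tendsto_id.const_mul_atTop (by positivity : 0 < 2 * a * r))).const_mul (y 0 ^ 2)
  have hsq_lim : Filter.Tendsto (fun t => y t ^ 2) Filter.atTop (nhds 0) :=
    squeeze_zero' (Filter.Eventually.of_forall fun t => sq_nonneg _)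
      ((Filter.eventually_ge_atTop 0).mono hdecay) hlim
  rw [tendsto_zero_iff_abs_tendsto_zero]
  simpa [Function.comp_def, Real.sqrt_sq_eq_abs] using hsq_lim.sqrt

/-- A differentiable function whose derivative is negative wherever it meets the level `b` stays
below `b` once it is below `b`. -/
theorem le_of_deriv_neg_of_eq {f : ℝ → ℝ} {b : ℝ} (hf : Differentiable ℝ f) (h0 : f 0 ≤ b)
    (h : ∀ t, 0 ≤ t → f t = b → deriv f t < 0) {t : ℝ} (ht : 0 ≤ t) : f t ≤ b :=
  image_le_of_deriv_right_lt_deriv_boundary (B := fun _ => b) (B' := fun _ => 0)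
    hf.continuous.continuousOn (fun s _ => (hf s).hasDerivAt.hasDerivWithinAt) h0
    (fun s => hasDerivAt_const s b) (fun s hs => h s hs.1) (Set.right_mem_Icc.2 ht)

/-- Without VSL control (`u = v_f`) and with demand `d⁻ > C`, the congested
equilibrium `k2` is globally attracting on `[0, k_j]`: every solution stays in
`[0, k_j]`, converges to `k2`, and the discharging flow-rate converges to the
dropped capacity `(1−Δ)C`. -/
theorem no_control_high_demand_globally_attracting_congestion
    (vf w kj C Δ dm l0 : ℝ)
    (hvf : 0 < vf) (hw : 0 < w) (hkj : 0 < kj)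
    (hC0 : 0 < C) (hCub : C < vf * w * kj / (vf + w))
    (hΔ0 : 0 < Δ) (hΔ1 : Δ < 1)
    (hl0 : 0 < l0) (hdm : C < dm)
    (k : ℝ → ℝ) (hk : Differentiable ℝ k)
    (hode : ∀ t : ℝ, 0 ≤ t →
      l0 * deriv k t = influx dm w kj vf (k t) - outflux vf C Δ (k t))
    (hk0l : 0 ≤ k 0) (hk0u : k 0 ≤ kj) :
    (∀ t : ℝ, 0 ≤ t → 0 ≤ k t ∧ k t ≤ kj) ∧
    Filter.Tendsto k Filter.atTop (nhds (kj - (1 - Δ) * C / w)) ∧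
    Filter.Tendsto (fun t => outflux vf C Δ (k t)) Filter.atTop (nhds ((1 - Δ) * C)) := by
  set k1 := C / vf with hk1
  set k2 := kj - (1 - Δ) * C / w with hk2
  set cap := vf * w * kj / (vf + w) with hcap
  have hvk1 : vf * k1 = C := by rw [hk1]; field_simp
  have hk1pos : 0 < k1 := by positivity
  have hwk2 : w * (kj - k2) = (1 - Δ) * C := by rw [hk2]; field_simp; ring
  have hdrop : 0 < (1 - Δ) * C := mul_pos (by linarith) hC0
  have hdrop' : (1 - Δ) * C < C := by nlinarith
  have hsupply : C < w * (kj - k1) := by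
    rw [hcap, lt_div_iff₀ (by positivity), ← hvk1] at hCub
    rw [← hvk1]
    nlinarith
  have hk1k2 : k1 < k2 := by nlinarith
  have hk2kj : k2 < kj := by nlinarith
  set c := min dm (min cap (w * (kj - k1))) - C with hc_def
  have hc : 0 < c := sub_pos.2 (lt_min hdm (lt_min hCub hsupply))
  have hflux_low : ∀ x, x ≤ k1 → c ≤ influx dm w kj vf x - outflux vf C Δ x := fun x hx => by
    rw [influx, outflux, if_pos hx]
    have hmin : min dm (min cap (w * (kj - k1))) ≤ min dm (min cap (w * (kj - x))) := by gcongr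
    have hvx : vf * x ≤ vf * k1 := by gcongr
    linarith
  have hflux_mid : ∀ x, k1 < x →
      min c (w * (k2 - x)) ≤ influx dm w kj vf x - outflux vf C Δ x := fun x hx => by
    rw [influx, outflux, if_neg hx.not_ge, le_sub_iff_add_le]
    have h1 : min c (w * (k2 - x)) ≤ c := min_le_left _ _
    have h2 : min c (w * (k2 - x)) ≤ w * (k2 - x) := min_le_right _ _
    have h3 : c + C ≤ dm := by rw [hc_def, sub_add_cancel]; exact min_le_left _ _
    have h4 : c + C ≤ cap := by
      rw [hc_def, sub_add_cancel]; exact (min_le_right _ _).trans (min_le_left _ _)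
    exact le_min (by linarith) (le_min (by linarith) (by linarith))
  have hflux_high : ∀ x, k1 < x →
      influx dm w kj vf x - outflux vf C Δ x ≤ w * (k2 - x) := fun x hx => by
    rw [influx, outflux, if_neg hx.not_ge]
    have hmin : min dm (min cap (w * (kj - x))) ≤ w * (kj - x) :=
      (min_le_right _ _).trans (min_le_right _ _)
    linarith
  have hdk : ∀ t, 0 ≤ t →
      deriv k t = l0⁻¹ * (influx dm w kj vf (k t) - outflux vf C Δ (k t)) := fun t ht => by
    rw [← hode t ht, inv_mul_cancel_left₀ hl0.ne']
  have hinv : 0 < l0⁻¹ := inv_pos.2 hl0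
  have hlim : Filter.Tendsto k Filter.atTop (nhds k2) := by
    rw [← tendsto_sub_nhds_zero_iff]
    refine tendsto_zero_of_mul_deriv_le hinv hc hw (hk.sub_const k2) fun t ht => ?_
    rw [deriv_sub_const, hdk t ht, mul_left_comm, ← mul_neg]
    refine mul_le_mul_of_nonneg_left ?_ hinv.le
    rcases le_or_gt (k t) k2 with hle | hgt
    · have hlow : min c (w * (k2 - k t)) ≤ influx dm w kj vf (k t) - outflux vf C Δ (k t) := by
        rcases le_or_gt (k t) k1 with h | h
        · exact (min_le_left _ _).trans (hflux_low _ h)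
        · exact hflux_mid _ h
      rw [abs_of_nonpos (sub_nonpos.2 hle), neg_sub]
      nlinarith [mul_le_mul_of_nonneg_left hlow (sub_nonneg.2 hle)]
    · rw [abs_of_pos (sub_pos.2 hgt), ← mul_neg]
      refine mul_le_mul_of_nonneg_left ?_ (sub_pos.2 hgt).le
      linarith [hflux_high _ (hk1k2.trans hgt), min_le_right c (w * (k t - k2))]
  refine ⟨fun t ht => ⟨?_, ?_⟩, hlim, ?_⟩
  · refine neg_nonpos.1 (le_of_deriv_neg_of_eq (f := fun s => -k s) hk.neg (neg_nonpos.2 hk0l)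
      (fun s hs hks => ?_) ht)
    rw [deriv.fun_neg, hdk s hs]
    exact neg_neg_of_pos (mul_pos hinv (hc.trans_le (hflux_low _ (by linarith))))
  · refine le_of_deriv_neg_of_eq hk hk0u (fun s hs hks => ?_) ht
    rw [hdk s hs]
    have hneg := hflux_high (k s) (by linarith)
    exact mul_neg_of_pos_of_neg hinv (by nlinarith)
  · refine tendsto_const_nhds.congr' ?_
    filter_upwards [hlim.eventually (lt_mem_nhds hk1k2)] with t ht
    rw [outflux, if_neg ht.not_ge]
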